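/- Let f : ℝ^m → ℝ be C¹ and suppose there are continuous functions L : ℝ^m → (0,∞) and r : ℝ^m → (0,∞) such that ‖∇f(x+v) − ∇f(x)‖ ≤ L(x)‖v‖ for all x ∈ ℝ^m and all v with ‖v‖ < r(x). Fix α, β ∈ (0,1) and δ₀ > 0. Assume that f is C² on a neighborhood of each of its generalized saddle points, and that for every generalized saddle point z of f one has α/L(z) ∉ {β^j δ₀ : j = 0,1,2,…}. Then there exists a Lebesgue-null set E₁ ⊆ ℝ^m such that for every x₀ ∈ ℝ^m \ E₁, if the local backtracking gradient descent sequence (x_n) from x₀ converges, then its limit is not a generalized saddle point of f. -/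

import Mathlib

open Gradient RealInnerProductSpace

/-- `δhat` is the local backtracking learning rate function associated with `f`, the local
Lipschitz-constant function `L`, the radius function `r`, and parameters `α, β, δ₀`:
`δhat x` is the largest number of the form `β^j δ₀` (i.e. the one with the smallest
exponent `j`) satisfying both `δ < α / L x` and `δ ‖∇f(x)‖ < r x / 2`. -/
def IsLocalBacktrackingRate {E : Type*} [NormedAddCommGroup E] [InnerProductSpace ℝ E]
    [CompleteSpace E] (f : E → ℝ) (L r : E → ℝ) (α β δ₀ : ℝ) (δhat : E → ℝ) : Prop :=
  ∀ x : E, ∃ j : ℕ, δhat x = β ^ j * δ₀ ∧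
    (δhat x < α / L x ∧ δhat x * ‖∇ f x‖ < r x / 2) ∧
    ∀ i < j, ¬ (β ^ i * δ₀ < α / L x ∧ β ^ i * δ₀ * ‖∇ f x‖ < r x / 2)

/-- `z` is a generalized saddle point of `f`: `f` is twice differentiable at `z` (i.e. the
gradient map `∇f` is differentiable at `z`), `∇f(z) = 0`, and the Hessian `D(∇f)(z)` has at
least one negative eigenvalue, i.e. `⟪∇²f(z)v, v⟫ < 0` for some `v`. -/
def IsGenSaddlePoint {E : Type*} [NormedAddCommGroup E] [InnerProductSpace ℝ E]
    [CompleteSpace E] (f : E → ℝ) (z : E) : Prop :=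
  ∇ f z = 0 ∧ DifferentiableAt ℝ (∇ f) z ∧ ∃ v : E, ⟪fderiv ℝ (∇ f) z v, v⟫ < 0

open Set Filter Topology MeasureTheory

section LinearAlgebra

variable {E : Type*} [NormedAddCommGroup E] [InnerProductSpace ℝ E]

/-- The quadratic form of a symmetric `T` is amplified by `a - δ T`, up to a negative defect. -/
lemma inner_smul_sub_smul_le {T : E →L[ℝ] E} (hT : (T : E →ₗ[ℝ] E).IsSymmetric) {a δ : ℝ}
    (hδ : 0 ≤ δ) (ha : δ * ‖T‖ ≤ a) (v : E) :
    ⟪T (a • v - δ • T v), a • v - δ • T v⟫ ≤ a ^ 2 * ⟪T v, v⟫ - δ * a * ‖T v‖ ^ 2 := by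
  have h1 : ⟪T (T v), v⟫ = ‖T v‖ ^ 2 := by
    rw [← real_inner_self_eq_norm_sq]; exact hT (T v) v
  have h2 : ⟪T v, T v⟫ = ‖T v‖ ^ 2 := real_inner_self_eq_norm_sq _
  have h3 : ⟪T (T v), T v⟫ ≤ ‖T‖ * ‖T v‖ ^ 2 := by
    calc ⟪T (T v), T v⟫ ≤ ‖T (T v)‖ * ‖T v‖ := real_inner_le_norm _ _
      _ ≤ (‖T‖ * ‖T v‖) * ‖T v‖ := by gcongr; exact T.le_opNorm _
      _ = _ := by ring
  have h4 : δ ^ 2 * ⟪T (T v), T v⟫ ≤ δ * a * ‖T v‖ ^ 2 := by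
    calc δ ^ 2 * ⟪T (T v), T v⟫ ≤ δ ^ 2 * (‖T‖ * ‖T v‖ ^ 2) := by gcongr
      _ = δ * (δ * ‖T‖) * ‖T v‖ ^ 2 := by ring
      _ ≤ _ := by gcongr
  simp only [map_sub, map_smul, inner_sub_left, inner_sub_right, real_inner_smul_left,
    real_inner_smul_right, h1, h2]
  nlinarith

lemma exists_perturbation_inner_le {T : E →L[ℝ] E} (hT : (T : E →ₗ[ℝ] E).IsSymmetric)
    {a δ κ : ℝ} (hδ : 0 < δ) (ha0 : 0 < a) (ha : δ * ‖T‖ ≤ a) (hκ : 0 < κ)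
    (hTκ : ∀ v, κ * ‖v‖ ≤ ‖T v‖) :
    ∃ ε > 0, ∀ v w : E, ‖w - (a • v - δ • T v)‖ ≤ ε * ‖v‖ → ⟪T w, w⟫ ≤ a ^ 2 * ⟪T v, v⟫ := by
  set C := ‖T‖ * (4 * a + 1) + 1 with hC
  have hCpos : 0 < C := by positivity
  have hε : 0 < min 1 (δ * a * κ ^ 2 / C) := by positivity
  refine ⟨_, hε, fun v w hvw => ?_⟩
  set ε := min 1 (δ * a * κ ^ 2 / C)
  have hε1 : ε ≤ 1 := min_le_left _ _
  have hε2 : ε * C ≤ δ * a * κ ^ 2 := (le_div_iff₀ hCpos).1 (min_le_right _ _)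
  set u := a • v - δ • T v with hu
  set e := w - u with he
  have hw : w = u + e := by simp [he]
  have hun : ‖u‖ ≤ 2 * a * ‖v‖ := by
    calc ‖u‖ ≤ ‖a • v‖ + ‖δ • T v‖ := norm_sub_le _ _
      _ = a * ‖v‖ + δ * ‖T v‖ := by
        rw [norm_smul, norm_smul, Real.norm_of_nonneg ha0.le, Real.norm_of_nonneg hδ.le]
      _ ≤ a * ‖v‖ + δ * (‖T‖ * ‖v‖) := by gcongr; exact T.le_opNorm _
      _ = a * ‖v‖ + (δ * ‖T‖) * ‖v‖ := by ring
      _ ≤ a * ‖v‖ + a * ‖v‖ := by gcongr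
      _ = _ := by ring
  have hTb : ∀ x y : E, ⟪T x, y⟫ ≤ ‖T‖ * ‖x‖ * ‖y‖ := fun x y =>
    (real_inner_le_norm _ _).trans (by gcongr; exact T.le_opNorm _)
  have h1 : ⟪T u, e⟫ ≤ ‖T‖ * (2 * a * ‖v‖) * (ε * ‖v‖) := (hTb u e).trans (by gcongr)
  have h2 : ⟪T e, e⟫ ≤ ‖T‖ * (1 * ‖v‖) * (ε * ‖v‖) :=
    (hTb e e).trans (by gcongr; exact hvw.trans (by gcongr))
  have h3 : ⟪T e, u⟫ = ⟪T u, e⟫ := by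
    rw [real_inner_comm]; exact (hT u e).symm
  have h4 := inner_smul_sub_smul_le hT hδ.le ha v
  have h5 : δ * a * (κ * ‖v‖) ^ 2 ≤ δ * a * ‖T v‖ ^ 2 := by gcongr; exact hTκ v
  have h6 : ε * C * ‖v‖ ^ 2 ≤ δ * a * κ ^ 2 * ‖v‖ ^ 2 := by gcongr
  have h7 : 0 ≤ ε * ‖v‖ ^ 2 := by positivity
  rw [hw, map_add, inner_add_left, inner_add_right, inner_add_right, h3]
  rw [hC] at h6
  nlinarith

/-- A symmetric operator with a negative direction can be shifted by a small positive multiple of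
the identity to an invertible operator which is still negative in that direction. -/
lemma exists_shift_bounded_below [FiniteDimensional ℝ E] (S : E →L[ℝ] E) {v : E}
    (hv : ⟪S v, v⟫ < 0) :
    ∃ c > (0 : ℝ), ∃ κ > (0 : ℝ), ⟪S v + c • v, v⟫ < 0 ∧ ∀ w, κ * ‖w‖ ≤ ‖S w + c • w‖ := by
  have hv0 : v ≠ 0 := by rintro rfl; simp at hv
  have hvn : 0 < ‖v‖ ^ 2 := by positivity
  have hfin : {c : ℝ | Module.End.HasEigenvalue (S : E →ₗ[ℝ] E) (-c)}.Finite :=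
    (Module.End.finite_hasEigenvalue (S : E →ₗ[ℝ] E)).preimage neg_injective.injOn
  obtain ⟨c, ⟨hc0, hc1⟩, hc⟩ :=
    (Set.Ioo_infinite (a := 0) (b := -⟪S v, v⟫ / ‖v‖ ^ 2) (by
      apply div_pos _ hvn; linarith)).exists_notMem_finite hfin
  set T : E →L[ℝ] E := S + c • ContinuousLinearMap.id ℝ E
  have hker : (T : E →ₗ[ℝ] E).ker = ⊥ := by
    rw [LinearMap.ker_eq_bot']
    intro w hw
    by_contra hw0
    refine hc (Module.End.hasEigenvalue_of_hasEigenvector (x := w) ⟨?_, hw0⟩)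
    rw [Module.End.mem_eigenspace_iff]
    have : S w + c • w = 0 := by simpa [T] using hw
    simpa using eq_neg_of_add_eq_zero_left this
  obtain ⟨K, hK, hKT⟩ := LinearMap.exists_antilipschitzWith (T : E →ₗ[ℝ] E) hker
  have hK' : (0 : ℝ) < K := hK
  refine ⟨c, hc0, (K : ℝ)⁻¹, by positivity, ?_, fun w => ?_⟩
  · rw [inner_add_left, real_inner_smul_left, real_inner_self_eq_norm_sq]
    rw [lt_div_iff₀ hvn] at hc1
    linarith
  · rw [inv_mul_le_iff₀ hK']
    have := hKT.le_mul_dist w 0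
    simpa [T] using this

end LinearAlgebra

/-- A discrete-time dynamical system has a neighbourhood of a linearly unstable fixed point in
which the set of points with non-escaping forward orbit is null. -/
lemma exists_nhds_measure_nonescaping_eq_zero {E : Type*} [NormedAddCommGroup E]
    [InnerProductSpace ℝ E] [FiniteDimensional ℝ E] [MeasurableSpace E] [BorelSpace E]
    (μ : Measure E) [μ.IsAddHaarMeasure] {G : E → E} (hG : Continuous G) {z : E}
    {S : E →L[ℝ] E} (hS : (S : E →ₗ[ℝ] E).IsSymmetric) {δ : ℝ} (hδ : 0 < δ)
    (hδS : δ * ‖S‖ ≤ 1) (hGz : HasStrictFDerivAt G (ContinuousLinearMap.id ℝ E - δ • S) z)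
    {v : E} (hv : ⟪S v, v⟫ < 0) :
    ∃ U ∈ 𝓝 z, μ {x | ∀ n, G^[n] x ∈ U} = 0 := by
  obtain ⟨c, hc, κ, hκ, hcv, hcκ⟩ := exists_shift_bounded_below S hv
  set T : E →L[ℝ] E := S + c • ContinuousLinearMap.id ℝ E
  have hTapp : ∀ w, T w = S w + c • w := fun w => by simp [T]
  set a := 1 + δ * c with ha_def
  have ha1 : 1 < a := by rw [ha_def]; nlinarith
  have hTs : (T : E →ₗ[ℝ] E).IsSymmetric := by
    intro x y
    have := hS x y
    simp only [ContinuousLinearMap.coe_coe] at this ⊢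
    rw [hTapp, hTapp, inner_add_left, inner_add_right, real_inner_smul_left,
      real_inner_smul_right, this]
  have hTn : δ * ‖T‖ ≤ a := by
    have h1 : ‖c • ContinuousLinearMap.id ℝ E‖ ≤ c := by
      rw [norm_smul, Real.norm_of_nonneg hc.le]
      exact mul_le_of_le_one_right hc.le ContinuousLinearMap.norm_id_le
    have h2 : ‖T‖ ≤ ‖S‖ + c := (norm_add_le _ _).trans (by gcongr)
    nlinarith
  obtain ⟨ε, hε, hpert⟩ := exists_perturbation_inner_le hTs hδ (by linarith) hTn hκ
    (fun w => by rw [hTapp]; exact hcκ w)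
  obtain ⟨s, hs, hsG⟩ := hGz.approximates_deriv_on_nhds (c := ⟨ε, hε.le⟩) (Or.inr hε)
  obtain ⟨ρ, hρ, hρs⟩ := Metric.nhds_basis_closedBall.mem_iff.1 hs
  refine ⟨Metric.closedBall z ρ, Metric.closedBall_mem_nhds z hρ, ?_⟩
  set W := {x | ∀ n, G^[n] x ∈ Metric.closedBall z ρ} with hW
  have hWclosed : IsClosed W := by
    simp only [hW, ofPred_forall]
    exact isClosed_iInter fun n => Metric.isClosed_closedBall.preimage (hG.iterate n)
  have hgrow : ∀ x ∈ W, ∀ y ∈ W, ∀ n, ⟪T (G^[n] x - G^[n] y), G^[n] x - G^[n] y⟫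
      ≤ a ^ (2 * n) * ⟪T (x - y), x - y⟫ := by
    intro x hx y hy n
    induction n with
    | zero => simp
    | succ n ih =>
      rw [Function.iterate_succ_apply', Function.iterate_succ_apply']
      have key := hpert (G^[n] x - G^[n] y) (G (G^[n] x) - G (G^[n] y)) (by
        have : _ ≤ ε * _ := hsG _ (hρs (hx n)) _ (hρs (hy n))
        convert this using 2
        simp only [sub_apply, ContinuousLinearMap.id_apply,
          smul_apply, hTapp, ha_def]
        module)
      refine key.trans ?_
      calc a ^ 2 * _ ≤ a ^ 2 * (a ^ (2 * n) * ⟪T (x - y), x - y⟫) := by gcongr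
        _ = _ := by ring
  have hcone : ∀ x ∈ W, ∀ y ∈ W, 0 ≤ ⟪T (x - y), x - y⟫ := by
    intro x hx y hy
    by_contra! hneg
    have hbd : ∀ n, -(‖T‖ * (2 * ρ) * (2 * ρ)) ≤ a ^ (2 * n) * ⟪T (x - y), x - y⟫ := by
      intro n
      refine le_trans ?_ (hgrow x hx y hy n)
      set d := G^[n] x - G^[n] y
      have hd : ‖d‖ ≤ 2 * ρ := by
        rw [← dist_eq_norm]
        have h1 : dist _ _ ≤ ρ := hx n
        have h2 : dist _ _ ≤ ρ := hy n
        linarith [dist_triangle_right (G^[n] x) (G^[n] y) z]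
      have : |⟪T d, d⟫| ≤ ‖T‖ * (2 * ρ) * (2 * ρ) :=
        (abs_real_inner_le_norm _ _).trans (by
          gcongr
          exact (T.le_opNorm _).trans (by gcongr))
      exact (abs_le.1 this).1
    have htend : Tendsto (fun n : ℕ => (a ^ 2) ^ n) atTop atTop :=
      tendsto_pow_atTop_atTop_of_one_lt (by nlinarith)
    have := htend.atTop_mul_const_of_neg hneg
    obtain ⟨n, hn⟩ := (this.eventually (eventually_lt_atBot (-(‖T‖ * (2 * ρ) * (2 * ρ))))).exists
    rw [← pow_mul] at hn
    linarith [hbd n]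
  have hvT : ⟪T v, v⟫ < 0 := by rw [hTapp]; exact hcv
  refine Measure.addHaar_eq_zero_of_disjoint_translates μ
    (fun n : ℕ => (1 / ((n : ℝ) + 1)) • v) ?_ ?_ hWclosed.measurableSet
  · have := (tendsto_one_div_add_atTop_nhds_zero_nat (𝕜 := ℝ)).smul_const v
    exact Metric.isBounded_range_of_tendsto _ this
  · intro i j hij
    rw [Function.onFun, Set.disjoint_left]
    rintro _ hx hy
    simp only [singleton_add, mem_image] at hx hy
    obtain ⟨x, hx, rfl⟩ := hx
    obtain ⟨y, hy, hxy⟩ := hy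
    have hd : x - y = (1 / ((j : ℝ) + 1) - 1 / ((i : ℝ) + 1)) • v := by
      rw [sub_smul, sub_eq_sub_iff_add_eq_add, add_comm, ← hxy, add_comm]
    have h0 : 1 / ((j : ℝ) + 1) - 1 / ((i : ℝ) + 1) ≠ 0 := by
      intro h
      apply hij
      have := sub_eq_zero.1 h
      simp only [one_div, inv_inj, add_left_inj, Nat.cast_inj] at this
      exact this.symm
    have := hcone x hx y hy
    rw [hd, map_smul, real_inner_smul_left, real_inner_smul_right] at this
    have : 0 < (1 / ((j : ℝ) + 1) - 1 / ((i : ℝ) + 1)) ^ 2 := by positivity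
    nlinarith

/-- Preimages of null sets under locally antilipschitz maps are null. -/
lemma measure_inter_preimage_eq_zero_of_locally_antilipschitz {E : Type*} [NormedAddCommGroup E]
    [NormedSpace ℝ E] [FiniteDimensional ℝ E] [MeasurableSpace E] [BorelSpace E]
    (μ : Measure E) [μ.IsAddHaarMeasure] {G : E → E} {s N : Set E}
    (hG : ∀ x ∈ s, ∃ K, ∃ u ∈ 𝓝 x, AntilipschitzWith K (u.domRestrict G)) (hN : μ N = 0) :
    μ (s ∩ G ⁻¹' N) = 0 := by
  refine measure_null_of_locally_null _ fun x hx => ?_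
  obtain ⟨K, u, hu, hK⟩ := hG x hx.1
  refine ⟨u ∩ G ⁻¹' N, ?_, ?_⟩
  · filter_upwards [mem_nhdsWithin_of_mem_nhds hu, self_mem_nhdsWithin] with y hyu hy
    exact ⟨hyu, hy.2⟩
  · set d := Module.finrank ℝ E
    have h1 : μH[d] N = 0 := Measure.absolutelyContinuous_isAddHaarMeasure μH[d] μ hN
    refine Measure.absolutelyContinuous_isAddHaarMeasure μ μH[d] ?_
    have h2 := hK.hausdorffMeasure_preimage_le (d := d) (by positivity) N
    rw [h1, mul_zero, nonpos_iff_eq_zero] at h2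
    rw [← (isometry_subtype_coe (s := u)).hausdorffMeasure_image (Or.inl (by positivity))] at h2
    convert h2
    ext y
    simp [and_comm]

section Gradient

variable {E : Type*} [NormedAddCommGroup E] [InnerProductSpace ℝ E] [CompleteSpace E]

lemma continuous_gradient {f : E → ℝ} (hf : ContDiff ℝ 1 f) : Continuous (∇ f) :=
  (InnerProductSpace.toDual ℝ E).symm.continuous.comp (hf.continuous_fderiv one_ne_zero)

lemma hasStrictFDerivAt_gradient {f : E → ℝ} {z : E} (hf : ContDiffAt ℝ 2 f z) :
    HasStrictFDerivAt (∇ f) (fderiv ℝ (∇ f) z) z := by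
  let e : (E →L[ℝ] ℝ) →L[ℝ] E :=
    { toFun := (InnerProductSpace.toDual ℝ E).symm
      map_add' := map_add _
      map_smul' := by simp
      cont := (InnerProductSpace.toDual ℝ E).symm.continuous }
  have h : ContDiffAt ℝ 1 (fderiv ℝ f) z := hf.fderiv_right (by norm_num)
  exact (e.contDiff.contDiffAt.comp z h).hasStrictFDerivAt one_ne_zero

lemma isSymmetric_fderiv_gradient {f : E → ℝ} {z : E} (hf : ContDiffAt ℝ 2 f z) :
    (fderiv ℝ (∇ f) z : E →ₗ[ℝ] E).IsSymmetric := by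
  have hd : DifferentiableAt ℝ (fderiv ℝ f) z :=
    (hf.fderiv_right (m := 1) (by norm_num)).differentiableAt one_ne_zero
  have key : ∀ v w : E, ⟪fderiv ℝ (∇ f) z v, w⟫ = fderiv ℝ (fderiv ℝ f) z v w := by
    intro v w
    have h1 : HasFDerivAt (fun x => ⟪∇ f x, w⟫) _ z :=
      (hasStrictFDerivAt_gradient hf).hasFDerivAt.inner ℝ (hasFDerivAt_const w z)
    have h2 : HasFDerivAt (fun x => fderiv ℝ f x w) _ z :=
      hd.hasFDerivAt.clm_apply (hasFDerivAt_const w z)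
    have h3 : (fun x => ⟪∇ f x, w⟫) = fun x => fderiv ℝ f x w := by
      ext x
      exact InnerProductSpace.toDual_symm_apply
    rw [h3] at h1
    have := congrArg (fun A : E →L[ℝ] ℝ => A v) (h1.unique h2)
    simpa [fderivInnerCLM_apply] using this
  intro v w
  simp only [ContinuousLinearMap.coe_coe]
  rw [key, real_inner_comm, key]
  exact hf.isSymmSndFDerivAt (by simp) _ _

lemma norm_fderiv_gradient_le {f L r : E → ℝ} {z : E} (hL : 0 ≤ L z) (hr : 0 < r z)
    (hlip : ∀ v, ‖v‖ < r z → ‖∇ f (z + v) - ∇ f z‖ ≤ L z * ‖v‖)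
    (hd : DifferentiableAt ℝ (∇ f) z) : ‖fderiv ℝ (∇ f) z‖ ≤ L z := by
  refine hd.hasFDerivAt.le_of_lip' hL ?_
  filter_upwards [Metric.ball_mem_nhds z hr] with x hx
  have := hlip (x - z) (by simpa [dist_eq_norm] using hx)
  simpa using this

namespace IsLocalBacktrackingRate

variable {f L r δhat : E → ℝ} {α β δ₀ : ℝ}

lemma pos (h : IsLocalBacktrackingRate f L r α β δ₀ δhat) (hβ : 0 < β) (hδ₀ : 0 < δ₀) (x : E) :
    0 < δhat x := by
  obtain ⟨j, hj, -⟩ := h x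
  rw [hj]
  positivity

lemma mul_lt (h : IsLocalBacktrackingRate f L r α β δ₀ δhat) (hL : ∀ x, 0 < L x) (x : E) :
    δhat x * L x < α := by
  obtain ⟨j, -, ⟨hj, -⟩, -⟩ := h x
  exact (lt_div_iff₀ (hL x)).1 hj

/-- The learning rate is locally constant at critical points where `α / L` avoids the grid. -/
lemma eventually_eq (h : IsLocalBacktrackingRate f L r α β δ₀ δhat) (hg : Continuous (∇ f))
    (hLc : Continuous L) (hrc : Continuous r) (hL : ∀ x, 0 < L x) (hr : ∀ x, 0 < r x) {z : E}
    (hz : ∇ f z = 0) (hgrid : ∀ j : ℕ, α / L z ≠ β ^ j * δ₀) :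
    ∀ᶠ x in 𝓝 z, δhat x = δhat z := by
  obtain ⟨j, hj, ⟨hj1, hj2⟩, hj3⟩ := h z
  have hαL : Continuous fun x => α / L x := continuous_const.div hLc fun x => (hL x).ne'
  have e1 : ∀ᶠ x in 𝓝 z, δhat z < α / L x :=
    hαL.continuousAt.eventually (lt_mem_nhds hj1)
  have e2 : ∀ᶠ x in 𝓝 z, δhat z * ‖∇ f x‖ < r x / 2 :=
    ContinuousAt.eventually_lt (by fun_prop) (by fun_prop) hj2
  have e3 : ∀ᶠ x in 𝓝 z, ∀ i ∈ Set.Iio j, α / L x < β ^ i * δ₀ := by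
    refine (Filter.eventually_all_finite (Set.finite_Iio j)).2 fun i hi => ?_
    refine hαL.continuousAt.eventually (gt_mem_nhds ?_)
    refine lt_of_le_of_ne (not_lt.1 fun hlt => hj3 i hi ⟨hlt, ?_⟩) (hgrid i)
    simpa [hz] using hr z
  filter_upwards [e1, e2, e3] with x h1 h2 h3
  obtain ⟨k, hk, ⟨hk1, -⟩, hk3⟩ := h x
  rw [hj] at h1 h2
  rcases lt_trichotomy k j with hkj | rfl | hjk
  · exact absurd (h3 k hkj) (by rw [hk] at hk1; exact hk1.not_gt)
  · rw [hj, hk]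
  · exact absurd ⟨h1, h2⟩ (hk3 j hjk)

end IsLocalBacktrackingRate

/-- A gradient step with step size below the inverse local Lipschitz constant is locally
antilipschitz. -/
lemma exists_antilipschitzWith_gradient_step {f L r : E → ℝ} (hLc : Continuous L)
    (hrc : Continuous r) {α d : ℝ} (hα : α < 1) (hd : 0 ≤ d) {x : E} (hrx : 0 < r x)
    (hlip : ∀ x v, ‖v‖ < r x → ‖∇ f (x + v) - ∇ f x‖ ≤ L x * ‖v‖) (hdx : d * L x < α) :
    ∃ K, ∃ u ∈ 𝓝 x, AntilipschitzWith K (u.domRestrict fun y => y - d • ∇ f y) := by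
  have e1 : ∀ᶠ y in 𝓝 x, d * L y < α :=
    (continuous_const.mul hLc).continuousAt.eventually (gt_mem_nhds hdx)
  have e2 : ∀ᶠ y in 𝓝 x, r x / 2 < r y :=
    hrc.continuousAt.eventually (lt_mem_nhds (half_lt_self hrx))
  refine ⟨(1 - α).toNNReal⁻¹, _,
    inter_mem (inter_mem e1 e2) (Metric.ball_mem_nhds x (ε := r x / 4) (by linarith)), ?_⟩
  refine AntilipschitzWith.of_le_mul_dist ?_
  rintro ⟨y, ⟨hy1, hy2⟩, hy3⟩ ⟨y', -, hy3'⟩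
  change d * L y < α at hy1
  change r x / 2 < r y at hy2
  rw [Metric.mem_ball] at hy3 hy3'
  have hα' : 0 < 1 - α := by linarith
  have hyy : ‖y' - y‖ < r y := by
    rw [← dist_eq_norm]
    linarith [dist_triangle_right y' y x]
  have h1 := hlip y (y' - y) hyy
  rw [add_sub_cancel] at h1
  simp only [Set.domRestrict_apply, Subtype.dist_eq]
  rw [NNReal.coe_inv, Real.coe_toNNReal _ hα'.le, le_inv_mul_iff₀ hα', dist_comm y y',
    dist_comm (y - _), dist_eq_norm, dist_eq_norm]
  have h2 : ‖y' - y‖ ≤ ‖(y' - d • ∇ f y') - (y - d • ∇ f y)‖ + ‖d • (∇ f y' - ∇ f y)‖ := by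
    refine le_trans (le_of_eq ?_) (norm_add_le _ _)
    congr 1
    module
  have h3 : ‖d • (∇ f y' - ∇ f y)‖ ≤ α * ‖y' - y‖ := by
    rw [norm_smul, Real.norm_of_nonneg hd]
    calc d * ‖∇ f y' - ∇ f y‖ ≤ d * (L y * ‖y' - y‖) := by gcongr
      _ = (d * L y) * ‖y' - y‖ := by ring
      _ ≤ _ := by gcongr
  linarith

end Gradient

/-- Under the local Lipschitz-gradient assumptions, if `f` is `C²` near its
generalized saddle points and `α / L(z)` avoids the step-size grid `{β^j δ₀}` at every
generalized saddle point `z`, then there is a Lebesgue-null set `E₁` such that for every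
initial point outside `E₁`, the local backtracking GD sequence, if it converges, does not
converge to a generalized saddle point. -/
theorem local_backtracking_GD_avoids_generalized_saddle_points
    {m : ℕ} (f : EuclideanSpace ℝ (Fin m) → ℝ) (hf : ContDiff ℝ 1 f)
    (L r : EuclideanSpace ℝ (Fin m) → ℝ) (hLcont : Continuous L) (hrcont : Continuous r)
    (hLpos : ∀ x, 0 < L x) (hrpos : ∀ x, 0 < r x)
    (hlip : ∀ x v, ‖v‖ < r x → ‖∇ f (x + v) - ∇ f x‖ ≤ L x * ‖v‖)
    (α β δ₀ : ℝ) (hα0 : 0 < α) (hα1 : α < 1) (hβ0 : 0 < β) (hβ1 : β < 1) (hδ₀ : 0 < δ₀)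
    (hC2 : ∀ z, IsGenSaddlePoint f z → ∃ U ∈ nhds z, ContDiffOn ℝ 2 f U)
    (hgrid : ∀ z, IsGenSaddlePoint f z → ∀ j : ℕ, α / L z ≠ β ^ j * δ₀)
    (δhat : EuclideanSpace ℝ (Fin m) → ℝ)
    (hδhat : IsLocalBacktrackingRate f L r α β δ₀ δhat) :
    ∃ E₁ : Set (EuclideanSpace ℝ (Fin m)), MeasureTheory.volume E₁ = 0 ∧
      ∀ x₀ ∉ E₁, ∀ x : ℕ → EuclideanSpace ℝ (Fin m), x 0 = x₀ →
        (∀ n, x (n + 1) = x n - δhat (x n) • ∇ f (x n)) →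
        ∀ p, Filter.Tendsto x Filter.atTop (nhds p) → ¬ IsGenSaddlePoint f p := by
  set g := ∇ f
  set H : EuclideanSpace ℝ (Fin m) → EuclideanSpace ℝ (Fin m) := fun x => x - δhat x • g x with hH
  have hg : Continuous g := continuous_gradient hf
  have hδpos := hδhat.pos hβ0 hδ₀
  have hδL := hδhat.mul_lt hLpos
  have hHnull : ∀ N : Set (EuclideanSpace ℝ (Fin m)), volume N = 0 → volume (H ⁻¹' N) = 0 := by
    intro N hN
    refine measure_mono_null (t := ⋃ j : ℕ, {x | δhat x = β ^ j * δ₀} ∩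
      (fun x => x - (β ^ j * δ₀) • g x) ⁻¹' N) ?_ (measure_iUnion_null fun j => ?_)
    · intro x hx
      obtain ⟨j, hj, -⟩ := hδhat x
      refine mem_iUnion.2 ⟨j, hj, ?_⟩
      rw [mem_preimage, ← hj]
      exact hx
    · refine measure_inter_preimage_eq_zero_of_locally_antilipschitz _ (fun x hx => ?_) hN
      refine exists_antilipschitzWith_gradient_step hLcont hrcont hα1 (by positivity) (hrpos x)
        hlip ?_
      rw [← show δhat x = β ^ j * δ₀ from hx]
      exact hδL x
  have hiter : ∀ (n : ℕ) (N : Set (EuclideanSpace ℝ (Fin m))), volume N = 0 →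
      volume (H^[n] ⁻¹' N) = 0 := by
    intro n
    induction n with
    | zero => exact fun N hN => hN
    | succ n ih =>
      intro N hN
      rw [Function.iterate_succ', preimage_comp]
      exact ih _ (hHnull N hN)
  have hloc : ∀ z ∈ {z | IsGenSaddlePoint f z}, ∃ U ∈ 𝓝 z,
      volume {x | ∀ n, H^[n] x ∈ U} = 0 := by
    intro z hz
    obtain ⟨hz0, hzd, v, hv⟩ := id hz
    obtain ⟨V, hV, hfV⟩ := hC2 z hz
    have hfz : ContDiffAt ℝ 2 f z := hfV.contDiffAt hV
    have hSn : δhat z * ‖fderiv ℝ g z‖ ≤ 1 := by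
      have := norm_fderiv_gradient_le (hLpos z).le (hrpos z) (hlip z) hzd
      nlinarith [hδpos z, hδL z]
    obtain ⟨U, hU, hU0⟩ := exists_nhds_measure_nonescaping_eq_zero volume
      (G := fun x => x - δhat z • g x) (by fun_prop) (isSymmetric_fderiv_gradient hfz) (hδpos z)
      hSn ((hasStrictFDerivAt_id z).sub ((hasStrictFDerivAt_gradient hfz).const_smul (δhat z))) hv
    have hev := hδhat.eventually_eq hg hLcont hrcont hLpos hrpos hz0 (hgrid z hz)
    refine ⟨_, inter_mem hU hev, measure_mono_null ?_ hU0⟩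
    intro x hx n
    suffices h : (fun x => x - δhat z • g x)^[n] x = H^[n] x from h ▸ (hx n).1
    clear hU0
    induction n with
    | zero => rfl
    | succ n ih =>
      rw [Function.iterate_succ_apply', Function.iterate_succ_apply', ih, hH]
      have : δhat (H^[n] x) = δhat z := (hx n).2
      simp only [← hH, this]
  choose! U hU hU0 using hloc
  obtain ⟨t, htS, htc, hcover⟩ := TopologicalSpace.countable_cover_nhdsWithin
    (f := fun z => interior (U z)) (s := {z | IsGenSaddlePoint f z})
    fun z hz => mem_nhdsWithin_of_mem_nhds (interior_mem_nhds.2 (hU z hz))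
  refine ⟨⋃ z ∈ t, ⋃ N : ℕ, H^[N] ⁻¹' {x | ∀ n, H^[n] x ∈ U z}, ?_, ?_⟩
  · exact (measure_biUnion_null_iff htc).2 fun z hz =>
      measure_iUnion_null fun N => hiter N _ (hU0 z (htS hz))
  · intro x₀ hx₀ x hx0 hx p hp hsad
    obtain ⟨z, hzt, hpz⟩ := mem_iUnion₂.1 (hcover hsad)
    obtain ⟨N, hN⟩ := eventually_atTop.1 (hp.eventually (isOpen_interior.mem_nhds hpz))
    have hxH : ∀ n, x n = H^[n] x₀ := by
      intro n
      induction n with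
      | zero => exact hx0
      | succ n ih => rw [Function.iterate_succ_apply', ← ih, hx n]
    refine hx₀ (mem_iUnion₂.2 ⟨z, hzt, mem_iUnion.2 ⟨N, fun n => ?_⟩⟩)
    rw [← Function.iterate_add_apply, ← hxH]
    exact interior_subset (hN _ (by omega))
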